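/- (Theorem 1, convergence of Subspace Thresholding Pursuit.) Let Φ ∈ ℝ^{m×N}, let S ⊆ {1,…,N} with |S| ≤ s, let x ∈ ℝ^N, e′ ∈ ℝ^m, and set y = Φx_S + e′. Suppose Φ satisfies the RIP of order 3s with constant δ < 1, let μ ≥ 0, and set ρ = 2δ(|μ−1| + μδ)√(1+2δ²)/(1−δ²). Assume ρ < 1. Let (S^n)_{n≥0} be a sequence of subsets of {1,…,N} with |S^n| ≤ s, and (x^n)_{n≥0} a sequence of vectors in ℝ^N, with S^0 = ∅ and x^0 = 0, such that for every n ≥ 1: supp(x^{n−1}) ⊆ S^{n−1}; there is a set ΔS of indices of the s largest magnitude entries of Φ*(y − Φx^{n−1}); setting S̃^n = S^{n−1} ∪ ΔS, x̃^n is a least-squares solution over support S̃^n for data y; U^n ⊆ S̃^n is a set of indices of the s largest magnitude entries of x̃^n; u^n = (x̃^n)_{U^n}; S^n is a set of indices of the s largest magnitude entries of u^n + μΦ*(y − Φu^n); and x^n is a least-squares solution over support S^n for data y. Set C = (√(2+√2)·δ(|μ−1|+μδ)/√(1−δ²) + 1)·((√(2(1−δ)) + √(1+δ))/(1−δ)) +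 √(4+√2)·(|μ−1|+μδ)/√(1−δ) and τ = C/(1−ρ). Then for every n ≥ 0, ‖x_S − x^n‖₂ ≤ ρⁿ·‖x_S‖₂ + τ·‖e′‖₂. -/

import Mathlib

open Matrix Finset

/-- The Euclidean norm of a vector in `ℝⁿ`. -/
noncomputable def norm2 {n : ℕ} (v : Fin n → ℝ) : ℝ := Real.sqrt (∑ i, (v i) ^ 2)

/-- The support of a vector: the set of indices of its nonzero entries. -/
noncomputable def supp {n : ℕ} (v : Fin n → ℝ) : Finset (Fin n) :=
  Finset.univ.filter (fun i => v i ≠ 0)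

/-- `restrict v T` keeps the entries of `v` with indices in `T` and sets all others to zero. -/
def restrict {n : ℕ} (v : Fin n → ℝ) (T : Finset (Fin n)) : Fin n → ℝ :=
  fun i => if i ∈ T then v i else 0

/-- `Φ` satisfies the restricted isometry property of order `t` with constant `δ`. -/
def RIP (m N : ℕ) (Φ : Matrix (Fin m) (Fin N) ℝ) (t : ℕ) (δ : ℝ) : Prop :=
  ∀ v : Fin N → ℝ, (supp v).card ≤ t →
    (1 - δ) * (norm2 v) ^ 2 ≤ (norm2 (Φ.mulVec v)) ^ 2 ∧
    (norm2 (Φ.mulVec v)) ^ 2 ≤ (1 + δ) * (norm2 v) ^ 2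

/-- `z` is a least-squares solution over support `T` for data `y`. -/
def IsLeastSquares {m N : ℕ} (Φ : Matrix (Fin m) (Fin N) ℝ) (y : Fin m → ℝ)
    (T : Finset (Fin N)) (z : Fin N → ℝ) : Prop :=
  supp z ⊆ T ∧ ∀ w : Fin N → ℝ, supp w ⊆ T →
    norm2 (y - Φ.mulVec z) ≤ norm2 (y - Φ.mulVec w)

/-- `U` is a set of indices of the `k` largest magnitude entries of `v`. -/
def IsLargest {n : ℕ} (v : Fin n → ℝ) (k : ℕ) (U : Finset (Fin n)) : Prop :=
  U.card = k ∧ ∀ i ∈ U, ∀ j ∉ U, |v j| ≤ |v i|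


noncomputable def nr {n : ℕ} (v : Fin n → ℝ) (T : Finset (Fin n)) : ℝ :=
  Real.sqrt (∑ i ∈ T, (v i) ^ 2)

lemma nr_nonneg {n : ℕ} (v : Fin n → ℝ) (T : Finset (Fin n)) : 0 ≤ nr v T := Real.sqrt_nonneg _

lemma nr_sq {n : ℕ} (v : Fin n → ℝ) (T : Finset (Fin n)) : nr v T ^ 2 = ∑ i ∈ T, (v i) ^ 2 :=
  Real.sq_sqrt (Finset.sum_nonneg fun _ _ => sq_nonneg _)

lemma norm2_eq_nr {n : ℕ} (v : Fin n → ℝ) : norm2 v = nr v Finset.univ := rfl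

lemma norm2_nonneg {n : ℕ} (v : Fin n → ℝ) : 0 ≤ norm2 v := Real.sqrt_nonneg _

lemma norm2_sq {n : ℕ} (v : Fin n → ℝ) : norm2 v ^ 2 = v ⬝ᵥ v := by
  rw [norm2_eq_nr, nr_sq, dotProduct]
  exact Finset.sum_congr rfl fun i _ => by ring

lemma norm2_restrict {n : ℕ} (v : Fin n → ℝ) (T : Finset (Fin n)) :
    norm2 (restrict v T) = nr v T := by
  unfold norm2 nr _root_.restrict
  congr 1
  rw [← Finset.sum_filter_add_sum_filter_not Finset.univ (· ∈ T)]
  rw [Finset.sum_eq_zero (s := Finset.univ.filter (· ∉ T))]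
  · rw [add_zero]
    refine Finset.sum_congr (by ext; simp) fun i hi => by simp [hi]
  · intro i hi
    simp at hi
    simp [hi]

lemma nr_mono {n : ℕ} (v : Fin n → ℝ) {T T' : Finset (Fin n)} (h : T ⊆ T') : nr v T ≤ nr v T' :=
  Real.sqrt_le_sqrt (Finset.sum_le_sum_of_subset_of_nonneg h fun _ _ _ => sq_nonneg _)

lemma nr_le_of {n : ℕ} (u v : Fin n → ℝ) (T : Finset (Fin n)) (h : ∀ i ∈ T, |u i| ≤ |v i|) :
    nr u T ≤ nr v T :=
  Real.sqrt_le_sqrt (Finset.sum_le_sum fun i hi => sq_le_sq.2 (h i hi))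

lemma nr_congr {n : ℕ} (u v : Fin n → ℝ) (T : Finset (Fin n)) (h : ∀ i ∈ T, u i = v i) :
    nr u T = nr v T := by
  unfold nr
  rw [Finset.sum_congr rfl fun i hi => by rw [h i hi]]

lemma nr_union {n : ℕ} (v : Fin n → ℝ) {T T' : Finset (Fin n)} (h : Disjoint T T') :
    nr v (T ∪ T') ^ 2 = nr v T ^ 2 + nr v T' ^ 2 := by
  rw [nr_sq, nr_sq, nr_sq, Finset.sum_union h]

lemma nr_smul {n : ℕ} (c : ℝ) (v : Fin n → ℝ) (T : Finset (Fin n)) :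
    nr (c • v) T = |c| * nr v T := by
  unfold nr
  rw [← Real.sqrt_sq_eq_abs, ← Real.sqrt_mul (sq_nonneg c), Finset.mul_sum]
  congr 1
  exact Finset.sum_congr rfl fun i _ => by simp; ring

lemma nr_add_le {n : ℕ} (u v : Fin n → ℝ) (T : Finset (Fin n)) :
    nr (u + v) T ≤ nr u T + nr v T := by
  have h := Real.sum_mul_le_sqrt_mul_sqrt T u v
  refine abs_le_of_sq_le_sq' ?_ (add_nonneg (nr_nonneg _ _) (nr_nonneg _ _)) |>.2
  have e : nr (u + v) T ^ 2 = nr u T ^ 2 + nr v T ^ 2 + 2 * ∑ i ∈ T, u i * v i := by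
    rw [nr_sq, nr_sq, nr_sq, Finset.mul_sum, ← Finset.sum_add_distrib, ← Finset.sum_add_distrib]
    exact Finset.sum_congr rfl fun i _ => by simp; ring
  have h' : ∑ i ∈ T, u i * v i ≤ nr u T * nr v T := h
  nlinarith

lemma dot_le {n : ℕ} (u v : Fin n → ℝ) : u ⬝ᵥ v ≤ norm2 u * norm2 v :=
  Real.sum_mul_le_sqrt_mul_sqrt Finset.univ u v

lemma norm2_eq_zero {n : ℕ} (u : Fin n → ℝ) (h : norm2 u = 0) : u = 0 := by
  have h2 := norm2_sq u
  rw [h] at h2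
  have : u ⬝ᵥ u = 0 := by rw [← h2]; norm_num
  exact dotProduct_self_eq_zero.1 this

lemma supp_subset {n : ℕ} {v : Fin n → ℝ} {T : Finset (Fin n)} (h : ∀ i ∉ T, v i = 0) :
    supp v ⊆ T := by
  intro i hi
  by_contra hc
  simp [supp] at hi
  exact hi (h i hc)

lemma zero_of_supp {n : ℕ} {v : Fin n → ℝ} {T : Finset (Fin n)} (h : supp v ⊆ T) {i : Fin n}
    (hi : i ∉ T) : v i = 0 := by
  by_contra hc
  exact hi (h (by simp [supp, hc]))

lemma rip_half {m N : ℕ} {Φ : Matrix (Fin m) (Fin N) ℝ} {t : ℕ} {δ : ℝ}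
    (hR : RIP m N Φ t δ) (T : Finset (Fin N)) (hT : T.card ≤ t) (u v : Fin N → ℝ)
    (hu : ∀ i ∉ T, u i = 0) (hv : ∀ i ∉ T, v i = 0) :
    2 * ((Φ *ᵥ u) ⬝ᵥ (Φ *ᵥ v) - u ⬝ᵥ v) ≤ δ * (norm2 u ^ 2 + norm2 v ^ 2) := by
  have h1 := (hR (u + v) ((Finset.card_le_card
    (supp_subset (T := T) fun i hi => by simp [hu i hi, hv i hi])).trans hT)).2
  have h2 := (hR (u - v) ((Finset.card_le_card
    (supp_subset (T := T) fun i hi => by simp [hu i hi, hv i hi])).trans hT)).1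
  simp only [norm2_sq, mulVec_add, mulVec_sub, add_dotProduct, sub_dotProduct, dotProduct_add,
    dotProduct_sub] at *
  have c1 := dotProduct_comm u v
  have c2 := dotProduct_comm (Φ *ᵥ u) (Φ *ᵥ v)
  rw [← c1, ← c2] at h1 h2
  linarith

lemma rip_inner {m N : ℕ} {Φ : Matrix (Fin m) (Fin N) ℝ} {t : ℕ} {δ : ℝ}
    (hR : RIP m N Φ t δ) (T : Finset (Fin N)) (hT : T.card ≤ t) (u v : Fin N → ℝ)
    (hu : ∀ i ∉ T, u i = 0) (hv : ∀ i ∉ T, v i = 0) :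
    (Φ *ᵥ u) ⬝ᵥ (Φ *ᵥ v) - u ⬝ᵥ v ≤ δ * (norm2 u * norm2 v) := by
  rcases (norm2_nonneg u).eq_or_lt with h0 | h0
  · rw [norm2_eq_zero u h0.symm]
    simp [norm2]
  rcases (norm2_nonneg v).eq_or_lt with h1 | h1
  · rw [norm2_eq_zero v h1.symm]
    simp [norm2]
  have h := rip_half hR T hT (norm2 v • u) (norm2 u • v) (fun i hi => by simp [hu i hi])
    (fun i hi => by simp [hv i hi])
  have e1 : norm2 (norm2 v • u) = norm2 v * norm2 u := by
    rw [norm2_eq_nr, nr_smul, abs_of_pos h1]; rfl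
  have e2 : norm2 (norm2 u • v) = norm2 u * norm2 v := by
    rw [norm2_eq_nr, nr_smul, abs_of_pos h0]; rfl
  rw [e1, e2] at h
  simp only [mulVec_smul, smul_dotProduct, dotProduct_smul, smul_eq_mul] at h
  have hp : 0 < norm2 u * norm2 v := mul_pos h0 h1
  refine le_of_mul_le_mul_left ?_ hp
  nlinarith

/-- the operator `Φ*Φ - I` -/
def EE {m N : ℕ} (Φ : Matrix (Fin m) (Fin N) ℝ) (h : Fin N → ℝ) : Fin N → ℝ :=
  Φᵀ *ᵥ (Φ *ᵥ h) - h

lemma dot_restrict {n : ℕ} (v : Fin n → ℝ) (T : Finset (Fin n)) :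
    v ⬝ᵥ restrict v T = nr v T ^ 2 := by
  rw [← norm2_restrict, norm2_sq]
  refine Finset.sum_congr rfl fun i _ => ?_
  simp only [_root_.restrict]
  split_ifs <;> simp

lemma tr_dot {m N : ℕ} (Φ : Matrix (Fin m) (Fin N) ℝ) (r : Fin m → ℝ) (z : Fin N → ℝ) :
    (Φᵀ *ᵥ r) ⬝ᵥ z = r ⬝ᵥ (Φ *ᵥ z) := by
  rw [dotProduct_mulVec, mulVec_transpose]

lemma EE_le {m N : ℕ} {Φ : Matrix (Fin m) (Fin N) ℝ} {t : ℕ} {δ : ℝ} (hδ : 0 ≤ δ)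
    (hR : RIP m N Φ t δ) (T : Finset (Fin N)) (hT : T.card ≤ t) (h : Fin N → ℝ)
    (hh : ∀ i ∉ T, h i = 0) (V : Finset (Fin N)) (hV : V ⊆ T) :
    nr (EE Φ h) V ≤ δ * norm2 h := by
  have h1 := rip_inner hR T hT h (restrict (EE Φ h) V) hh
    (fun i hi => by
      simp only [_root_.restrict]
      rw [if_neg fun hc => hi (hV hc)])
  rw [← tr_dot, ← sub_dotProduct] at h1
  change (EE Φ h) ⬝ᵥ _ ≤ _ at h1
  rw [dot_restrict, norm2_restrict] at h1
  rcases (nr_nonneg (EE Φ h) V).eq_or_lt with h0 | h0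
  · rw [← h0]; exact mul_nonneg hδ (norm2_nonneg _)
  · refine le_of_mul_le_mul_right ?_ h0
    nlinarith

lemma tr_le {m N : ℕ} {Φ : Matrix (Fin m) (Fin N) ℝ} {t : ℕ} {δ : ℝ} (hδ : 0 ≤ δ)
    (hR : RIP m N Φ t δ) (T : Finset (Fin N)) (hT : T.card ≤ t) (e : Fin m → ℝ) :
    nr (Φᵀ *ᵥ e) T ≤ Real.sqrt (1 + δ) * norm2 e := by
  set z := restrict (Φᵀ *ᵥ e) T with hz
  have h1 := (hR z ((Finset.card_le_card
    (supp_subset (T := T) fun i hi => by simp [hz, _root_.restrict, hi])).trans hT)).2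
  have h2 : nr (Φᵀ *ᵥ e) T ^ 2 ≤ norm2 e * norm2 (Φ *ᵥ z) := by
    rw [← dot_restrict, tr_dot]; exact dot_le _ _
  have h3 : norm2 (Φ *ᵥ z) ≤ Real.sqrt (1 + δ) * norm2 z := by
    refine abs_le_of_sq_le_sq' ?_ (mul_nonneg (Real.sqrt_nonneg _) (norm2_nonneg _)) |>.2
    rw [mul_pow, Real.sq_sqrt (by linarith)]; exact h1
  rw [hz, norm2_restrict] at h3
  rcases (nr_nonneg (Φᵀ *ᵥ e) T).eq_or_lt with h0 | h0
  · rw [← h0]; exact mul_nonneg (Real.sqrt_nonneg _) (norm2_nonneg _)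
  · refine le_of_mul_le_mul_right ?_ h0
    have := mul_le_mul_of_nonneg_left h3 (norm2_nonneg e)
    nlinarith

lemma ls_normal {m N : ℕ} {Φ : Matrix (Fin m) (Fin N) ℝ} {y : Fin m → ℝ} {T : Finset (Fin N)}
    {z : Fin N → ℝ} (h : IsLeastSquares Φ y T z) (i : Fin N) (hi : i ∈ T) :
    (Φᵀ *ᵥ (y - Φ *ᵥ z)) i = 0 := by
  set r := y - Φ *ᵥ z with hr
  set c := (Φᵀ *ᵥ r) i with hc
  set f : Fin N → ℝ := Pi.single i 1 with hf
  set b := (Φ *ᵥ f) ⬝ᵥ (Φ *ᵥ f) with hb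
  have hcf : r ⬝ᵥ (Φ *ᵥ f) = c := by rw [← tr_dot]; simp [hf, hc]
  have key : ∀ s : ℝ, 0 ≤ s ^ 2 * b - 2 * s * c := by
    intro s
    have h1 := h.2 (z + s • f) (supp_subset fun j hj => by
      have : j ≠ i := fun hc => hj (hc ▸ hi)
      simp [hf, this, zero_of_supp h.1 hj])
    have h2 : norm2 (y - Φ *ᵥ z) ^ 2 ≤ norm2 (y - Φ *ᵥ (z + s • f)) ^ 2 :=
      pow_le_pow_left₀ (norm2_nonneg _) h1 2
    have e : y - Φ *ᵥ (z + s • f) = r - s • (Φ *ᵥ f) := by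
      rw [mulVec_add, mulVec_smul, hr]; abel
    rw [e, norm2_sq, norm2_sq, ← hr] at h2
    simp only [sub_dotProduct, dotProduct_sub, smul_dotProduct, dotProduct_smul, smul_eq_mul,
      dotProduct_comm (Φ *ᵥ f) r, hcf] at h2
    rw [← hb] at h2
    nlinarith
  have hb0 : 0 ≤ b := by rw [hb, ← norm2_sq]; positivity
  have h3 := key (c / (b + 1))
  have hb1 : 0 < b + 1 := by linarith
  have e : (c / (b + 1)) ^ 2 * b - 2 * (c / (b + 1)) * c = - (c ^ 2 * (b + 2) / (b + 1) ^ 2) := by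
    field_simp; ring
  rw [e] at h3
  by_contra hne
  have : 0 < c ^ 2 * (b + 2) / (b + 1) ^ 2 := by positivity
  linarith

lemma largest_le {n : ℕ} {g : Fin n → ℝ} {s : ℕ} {V : Finset (Fin n)} (h : IsLargest g s V)
    (S : Finset (Fin n)) (hS : S.card ≤ s) : nr g (S \ V) ≤ nr g (V \ S) := by
  have hc : (S \ V).card ≤ (V \ S).card := by
    have h1 := Finset.card_sdiff_add_card_inter S V
    have h2 := Finset.card_sdiff_add_card_inter V S
    rw [Finset.inter_comm] at h2
    have := h.1
    omega
  apply Real.sqrt_le_sqrt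
  rcases (V \ S).eq_empty_or_nonempty with h0 | h0
  · rw [h0, Finset.card_empty] at hc
    rw [Finset.card_eq_zero.1 (Nat.le_zero.1 hc), h0]
  obtain ⟨j, hj, hmin⟩ := Finset.exists_min_image (V \ S) (fun i => g i ^ 2) h0
  calc ∑ i ∈ S \ V, g i ^ 2 ≤ (S \ V).card • (g j ^ 2) :=
        Finset.sum_le_card_nsmul _ _ _ fun i hi =>
          sq_le_sq.2 (h.2 j (Finset.mem_sdiff.1 hj).1 i (Finset.mem_sdiff.1 hi).2)
    _ ≤ (V \ S).card • (g j ^ 2) := nsmul_le_nsmul_left (sq_nonneg _) hc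
    _ ≤ _ := Finset.card_nsmul_le_sum _ _ _ hmin

lemma sel {n : ℕ} {g : Fin n → ℝ} {s : ℕ} {V : Finset (Fin n)} (h : IsLargest g s V)
    (S : Finset (Fin n)) (hS : S.card ≤ s) (x r : Fin n → ℝ)
    (hj : ∀ j ∈ V, j ∉ S → |g j| ≤ |r j|) (hi : ∀ i ∈ S, i ∉ V → |x i| ≤ |g i| + |r i|) :
    nr x (S \ V) ≤ Real.sqrt 2 * nr r ((S \ V) ∪ (V \ S)) := by
  have h1 := largest_le h S hS
  have h2 : nr g (V \ S) ≤ nr r (V \ S) := nr_le_of _ _ _ fun j hj' => by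
    rw [Finset.mem_sdiff] at hj'; exact hj j hj'.1 hj'.2
  have h3 : nr x (S \ V) ≤ nr ((fun i => |g i|) + fun i => |r i|) (S \ V) :=
    nr_le_of _ _ _ fun i hi' => by
      rw [Finset.mem_sdiff] at hi'
      exact (hi i hi'.1 hi'.2).trans (le_abs_self _)
  have h4 := nr_add_le (fun i => |g i|) (fun i => |r i|) (S \ V)
  have h5 : nr (fun i => |g i|) (S \ V) = nr g (S \ V) := by simp [nr]
  have h6 : nr (fun i => |r i|) (S \ V) = nr r (S \ V) := by simp [nr]
  have h7 := nr_union r (T := S \ V) (T' := V \ S)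
    (Finset.disjoint_left.2 fun a ha hb => (Finset.mem_sdiff.1 ha).2 (Finset.mem_sdiff.1 hb).1)
  refine abs_le_of_sq_le_sq' ?_ (mul_nonneg (Real.sqrt_nonneg _) (nr_nonneg _ _)) |>.2
  rw [mul_pow, Real.sq_sqrt (by norm_num), h7]
  have h8 : nr x (S \ V) ≤ nr r (S \ V) + nr r (V \ S) := by linarith
  have := pow_le_pow_left₀ (nr_nonneg _ _) h8 2
  nlinarith [sq_nonneg (nr r (S \ V) - nr r (V \ S))]

lemma ls_err {m N : ℕ} {Φ : Matrix (Fin m) (Fin N) ℝ} {t : ℕ} {δ : ℝ} (hδ : 0 ≤ δ)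
    (hR : RIP m N Φ t δ) {S T : Finset (Fin N)} (hT : (S ∪ T).card ≤ t) {x z : Fin N → ℝ}
    {e y : Fin m → ℝ} (hx : ∀ i ∉ S, x i = 0) (hy : y = Φ *ᵥ x + e)
    (h : IsLeastSquares Φ y T z) :
    nr (x - z) T ≤ δ * norm2 (x - z) + Real.sqrt (1 + δ) * norm2 e ∧
    norm2 (x - z) ^ 2 = nr x Tᶜ ^ 2 + nr (x - z) T ^ 2 := by
  constructor
  · have e1 : ∀ i ∈ T, (x - z) i = ((-1 : ℝ) • (EE Φ (x - z) + Φᵀ *ᵥ e)) i := by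
      intro i hi
      have := ls_normal h i hi
      have e2 : y - Φ *ᵥ z = Φ *ᵥ (x - z) + e := by rw [hy, mulVec_sub]; abel
      rw [e2, mulVec_add] at this
      simp only [EE, Pi.add_apply, Pi.smul_apply, Pi.sub_apply, smul_eq_mul] at *
      linarith
    rw [nr_congr _ _ _ e1, nr_smul]
    have h1 := nr_add_le (EE Φ (x - z)) (Φᵀ *ᵥ e) T
    have h2 := EE_le hδ hR (S ∪ T) hT (x - z) (fun i hi => by
      rw [Finset.mem_union, not_or] at hi
      simp [hx i hi.1, zero_of_supp h.1 hi.2]) T Finset.subset_union_right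
    have h3 := tr_le hδ hR T ((Finset.card_le_card Finset.subset_union_right).trans hT) e
    norm_num
    linarith
  · rw [norm2_eq_nr, ← Finset.union_compl T, nr_union _ disjoint_compl_right, add_comm]
    congr 2
    exact nr_congr _ _ _ fun i hi => by
      rw [Finset.mem_compl] at hi
      simp [zero_of_supp h.1 hi]

lemma nr_compl {n : ℕ} {x : Fin n → ℝ} {S : Finset (Fin n)} (hx : ∀ i ∉ S, x i = 0)
    (T : Finset (Fin n)) : nr x Tᶜ = nr x (S \ T) := by
  unfold nr
  congr 1
  symm
  refine Finset.sum_subset (fun i hi => by simp at hi ⊢; exact hi.2) fun i hi hn => ?_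
  have : i ∉ S := fun hc => hn (by simp at hi ⊢; exact ⟨hc, hi⟩)
  rw [hx i this]; norm_num

lemma step_vec {m N : ℕ} {Φ : Matrix (Fin m) (Fin N) ℝ} {s : ℕ} {δ μ : ℝ} (hδ : 0 ≤ δ)
    (hμ : 0 ≤ μ) (hR : RIP m N Φ (3 * s) δ) {S : Finset (Fin N)} (hS : S.card ≤ s)
    {X : Fin N → ℝ} (hX : ∀ i ∉ S, X i = 0) {e y : Fin m → ℝ} (hy : y = Φ *ᵥ X + e)
    {P : Finset (Fin N)} (hP : P.card ≤ s) {xp : Fin N → ℝ} (hxp : IsLeastSquares Φ y P xp)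
    {Δ : Finset (Fin N)} (hΔ : IsLargest (Φᵀ *ᵥ (y - Φ *ᵥ xp)) s Δ)
    {xt : Fin N → ℝ} (hxt : IsLeastSquares Φ y (P ∪ Δ) xt)
    {U : Finset (Fin N)} (hUZ : U ⊆ P ∪ Δ) (hU : IsLargest xt s U)
    {V : Finset (Fin N)} (hV : IsLargest (fun i => _root_.restrict xt U i +
              μ * (Φᵀ *ᵥ (y - Φ *ᵥ (_root_.restrict xt U))) i) s V)
    {xn : Fin N → ℝ} (hxn : IsLeastSquares Φ y V xn)
    (κ : ℝ) (hκ : κ = Real.sqrt (1 + δ) * norm2 e) :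
    ∃ p a D w q α : ℝ, 0 ≤ p ∧ 0 ≤ a ∧ 0 ≤ D ∧ 0 ≤ w ∧ 0 ≤ q ∧ 0 ≤ α ∧
      p ≤ Real.sqrt 2 * (δ * norm2 (X - xp) + κ) ∧
      D ^ 2 = p ^ 2 + a ^ 2 ∧ a ≤ δ * D + κ ∧ w ^ 2 ≤ p ^ 2 + 3 * a ^ 2 ∧
      norm2 (X - xn) ^ 2 = q ^ 2 + α ^ 2 ∧ α ≤ δ * norm2 (X - xn) + κ ∧
      q ≤ Real.sqrt 2 * (|μ - 1| * w + μ * (δ * w + κ)) ∧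
      (1 ≤ μ → q ≤ Real.sqrt 2 * ((μ - 1) * a + μ * (δ * w + κ))) ∧
      (1 ≤ μ → ∃ r1 r2 : ℝ, 0 ≤ r1 ∧ 0 ≤ r2 ∧ q ≤ Real.sqrt 2 * (r1 + μ * δ * r2) ∧
        r1 ^ 2 ≤ a ^ 2 + (μ * κ) ^ 2 ∧ r2 ^ 2 ≤ a ^ 2 + w ^ 2) := by
  set Z := P ∪ Δ with hZ
  have hΔc := hΔ.1
  have hUc := hU.1
  have hVc := hV.1
  have hPΔ := Finset.card_union_le P Δ
  have card3 : ∀ A B : Finset (Fin N), A.card ≤ s → B.card ≤ s → (S ∪ A ∪ B).card ≤ 3 * s := by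
    intro A B hA hB
    have h1 := Finset.card_union_le (S ∪ A) B
    have h2 := Finset.card_union_le S A
    omega
  have hSZ : (S ∪ Z).card ≤ 3 * s := by
    rw [hZ, ← Finset.union_assoc]; exact card3 P Δ hP hΔc.le
  have hSV : (S ∪ V).card ≤ 3 * s := by
    have := card3 V ∅ hVc.le (by simp)
    simpa using this
  obtain ⟨ha, hD⟩ := ls_err hδ hR hSZ hX hy hxt
  obtain ⟨hα, ht'⟩ := ls_err hδ hR hSV hX hy hxn
  rw [← hκ] at ha hα
  set d := X - xt with hd
  set u := _root_.restrict xt U with hu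
  set h := X - u with hh
  have huU : ∀ i ∈ U, u i = xt i := fun i hi => by simp [hu, _root_.restrict, hi]
  have huU' : ∀ i ∉ U, u i = 0 := fun i hi => by simp [hu, _root_.restrict, hi]
  have hp : nr X Zᶜ ≤ Real.sqrt 2 * (δ * norm2 (X - xp) + κ) := by
    set v := X - xp with hv
    set r : Fin N → ℝ := fun i => if i ∈ P then 0 else (EE Φ v + Φᵀ *ᵥ e) i with hr
    have eg : ∀ i, (Φᵀ *ᵥ (y - Φ *ᵥ xp)) i = v i + (EE Φ v + Φᵀ *ᵥ e) i := by
      intro i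
      have : y - Φ *ᵥ xp = Φ *ᵥ v + e := by rw [hy, hv, mulVec_sub]; abel
      rw [this, mulVec_add]
      simp only [EE, Pi.add_apply, Pi.sub_apply]
      ring
    have h1 := sel hΔ S hS (_root_.restrict X Pᶜ) r (by
      intro j hj hjS
      by_cases hjP : j ∈ P
      · rw [ls_normal hxp j hjP]; simp
      · have : v j = 0 := by simp [hv, hX j hjS, zero_of_supp hxp.1 hjP]
        rw [eg, this]; simp [hr, hjP]) (by
      intro i hi hiΔ
      by_cases hiP : i ∈ P
      · simp only [_root_.restrict, Finset.mem_compl, hiP, not_true, if_false, abs_zero]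
        positivity
      · rw [eg]
        simp only [_root_.restrict, Finset.mem_compl, hiP, not_false_iff, if_true, hr, if_false]
        have : v i = X i := by simp [hv, zero_of_supp hxp.1 hiP]
        rw [this]
        calc |X i| = |(X i + (EE Φ v + Φᵀ *ᵥ e) i) - (EE Φ v + Φᵀ *ᵥ e) i| := by
              rw [add_sub_cancel_right]
          _ ≤ _ := abs_sub _ _)
    have h2 : nr X Zᶜ ≤ nr (_root_.restrict X Pᶜ) (S \ Δ) := by
      rw [nr_compl hX]
      have h3 : nr X (S \ Z) = nr (_root_.restrict X Pᶜ) (S \ Z) :=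
        nr_congr _ _ _ fun i hi => by
          simp [hZ] at hi
          simp [_root_.restrict, hi.2]
      rw [h3]
      refine nr_mono _ fun i hi => ?_
      simp [hZ] at hi ⊢
      exact ⟨hi.1, hi.2.2⟩
    have h4 : nr r ((S \ Δ) ∪ (Δ \ S)) ≤ nr (EE Φ v + Φᵀ *ᵥ e) ((S \ Δ) ∪ (Δ \ S)) :=
      nr_le_of _ _ _ fun i _ => by
        simp only [hr]
        split_ifs
        · simp
        · exact le_rfl
    have h5 := nr_add_le (EE Φ v) (Φᵀ *ᵥ e) ((S \ Δ) ∪ (Δ \ S))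
    have hsub : (S \ Δ) ∪ (Δ \ S) ⊆ S ∪ P ∪ Δ := by
      intro i; simp; tauto
    have h6 := EE_le hδ hR (S ∪ P ∪ Δ) (card3 P Δ hP hΔc.le) v (fun i hi => by
      simp only [Finset.mem_union, not_or] at hi
      simp [hv, hX i hi.1.1, zero_of_supp hxp.1 hi.1.2]) _ hsub
    have h7 := tr_le hδ hR _ ((Finset.card_le_card hsub).trans (card3 P Δ hP hΔc.le)) e
    rw [← hκ] at h7
    refine (h2.trans h1).trans (mul_le_mul_of_nonneg_left ?_ (Real.sqrt_nonneg _))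
    linarith
  have hZU : Z = U ∪ (Z \ U) := (Finset.union_sdiff_of_subset hUZ).symm
  have hpr : nr X (Z \ U) ≤ Real.sqrt 2 * nr d Z := by
    have h1 := sel hU S hS (_root_.restrict X Z) (_root_.restrict d Z) (by
      intro j hj hjS
      simp [_root_.restrict, hUZ hj, hd, hX j hjS]) (by
      intro i hi hiU
      by_cases hiZ : i ∈ Z
      · simp only [_root_.restrict, hiZ, if_true]
        calc |X i| = |xt i + d i| := by simp [hd]
          _ ≤ _ := abs_add_le _ _
      · simp only [_root_.restrict, hiZ, if_false, abs_zero]; positivity)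
    have h2 : nr X (Z \ U) ≤ nr (_root_.restrict X Z) (S \ U) := by
      have h3 : nr X (Z \ U) = nr (_root_.restrict X Z) (Z \ U) :=
        nr_congr _ _ _ fun i hi => by
          simp at hi
          simp [_root_.restrict, hi.1]
      have h4 := nr_compl (x := _root_.restrict X Z) (S := S)
        (fun i hi => by simp [_root_.restrict, hX i hi]) U
      rw [h3, ← h4]
      exact nr_mono _ fun i hi => by simp at hi ⊢; exact hi.2
    have h5 : nr (_root_.restrict d Z) ((S \ U) ∪ (U \ S)) ≤ nr d Z := by
      rw [← norm2_restrict d Z]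
      exact nr_mono _ (Finset.subset_univ _)
    exact (h2.trans h1).trans (mul_le_mul_of_nonneg_left h5 (Real.sqrt_nonneg _))
  have hdU : nr d U ≤ nr d Z := nr_mono _ hUZ
  have hw : norm2 h ^ 2 ≤ nr X Zᶜ ^ 2 + 3 * nr d Z ^ 2 := by
    have e1 : norm2 h ^ 2 = nr h U ^ 2 + nr h (Z \ U) ^ 2 + nr h Zᶜ ^ 2 := by
      rw [← nr_union _ Finset.disjoint_sdiff, ← hZU, ← nr_union _ disjoint_compl_right,
        Finset.union_compl]; rfl
    have e2 : nr h U = nr d U := nr_congr _ _ _ fun i hi => by simp [hh, hd, huU i hi]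
    have e3 : nr h (Z \ U) = nr X (Z \ U) := nr_congr _ _ _ fun i hi => by
      simp at hi
      simp [hh, huU' i hi.2]
    have e4 : nr h Zᶜ = nr X Zᶜ := nr_congr _ _ _ fun i hi => by
      simp only [Finset.mem_compl] at hi
      simp [hh, huU' i fun hc => hi (hUZ hc)]
    rw [e1, e2, e3, e4]
    have h1 := pow_le_pow_left₀ (nr_nonneg _ _) hpr 2
    rw [mul_pow, Real.sq_sqrt (by norm_num)] at h1
    have h2 := pow_le_pow_left₀ (nr_nonneg _ _) hdU 2
    linarith
  have hxtU : nr xt (Z \ U) ≤ nr d Z := by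
    have h1 := largest_le hU S hS
    have e1 : nr xt (Z \ U) ^ 2 ≤ nr xt (S \ U) ^ 2 + nr d ((Z \ U) \ S) ^ 2 := by
      have : nr d ((Z \ U) \ S) = nr xt ((Z \ U) \ S) := by
        have h3 : nr d ((Z \ U) \ S) = nr ((-1 : ℝ) • xt) ((Z \ U) \ S) :=
          nr_congr _ _ _ fun i hi => by
            simp at hi
            simp [hd, hX i hi.2]
        rw [h3, nr_smul]; simp
      rw [this, ← nr_union _ (by
        rw [Finset.disjoint_left]; intro i; simp; tauto)]
      exact pow_le_pow_left₀ (nr_nonneg _ _) (nr_mono _ fun i => by simp; tauto) 2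
    have e2 : nr xt (U \ S) = nr d (U \ S) := by
      have h3 : nr d (U \ S) = nr ((-1 : ℝ) • xt) (U \ S) :=
          nr_congr _ _ _ fun i hi => by
            simp at hi
            simp [hd, hX i hi.2]
      rw [h3, nr_smul]; simp
    have e3 : nr d (U \ S) ^ 2 + nr d ((Z \ U) \ S) ^ 2 ≤ nr d Z ^ 2 := by
      rw [← nr_union _ (by rw [Finset.disjoint_left]; intro i; simp; tauto)]
      exact pow_le_pow_left₀ (nr_nonneg _ _) (nr_mono _ fun i hi => by
        simp only [Finset.mem_union, Finset.mem_sdiff] at hi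
        rcases hi with hi | hi
        · exact hUZ hi.1
        · exact hi.1.1) 2
    rw [e2] at h1
    have h1' := pow_le_pow_left₀ (nr_nonneg _ _) h1 2
    exact abs_le_of_sq_le_sq' (by linarith) (nr_nonneg _ _) |>.2
  set W := (S \ V) ∪ (V \ S) with hW
  have hWsub : W ⊆ S ∪ U ∪ V := by
    intro i; simp [hW]; tauto
  have hT3 := card3 U V hUc.le hVc.le
  have hh0 : ∀ i ∉ S ∪ U ∪ V, h i = 0 := fun i hi => by
    simp only [Finset.mem_union, not_or] at hi
    simp [hh, hX i hi.1.1, huU' i hi.1.2]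
  have hEh := EE_le hδ hR _ hT3 h hh0 _ hWsub
  have hPe := tr_le hδ hR W ((Finset.card_le_card hWsub).trans hT3) e
  rw [← hκ] at hPe
  set b : Fin N → ℝ := μ • (EE Φ h + Φᵀ *ᵥ e) with hb
  have hbW : nr b W ≤ μ * (δ * norm2 h + κ) := by
    rw [hb, nr_smul, abs_of_nonneg hμ]
    refine mul_le_mul_of_nonneg_left ?_ hμ
    have := nr_add_le (EE Φ h) (Φᵀ *ᵥ e) W
    linarith
  have eg : ∀ i, u i + μ * (Φᵀ *ᵥ (y - Φ *ᵥ u)) i = X i + (μ - 1) * h i + b i := by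
    intro i
    have : y - Φ *ᵥ u = Φ *ᵥ h + e := by rw [hy, hh, mulVec_sub]; abel
    have e2 : u i = X i - h i := by simp [hh]
    rw [this, mulVec_add, e2]
    simp only [EE, hb, Pi.add_apply, Pi.sub_apply, Pi.smul_apply, smul_eq_mul]
    ring
  have hq : nr X Vᶜ = nr X (S \ V) := nr_compl hX V
  refine ⟨nr X Zᶜ, nr d Z, norm2 d, norm2 h, nr X Vᶜ, nr (X - xn) V, nr_nonneg _ _, nr_nonneg _ _,
    norm2_nonneg _, norm2_nonneg _, nr_nonneg _ _, nr_nonneg _ _, hp, hD, ha, hw, ht', hα, ?_⟩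
  rw [hq]
  constructor
  · have h1 := sel hV S hS X ((μ - 1) • h + b) (by
      intro j hj hjS
      rw [eg, hX j hjS]; simp) (by
      intro i hi hiV
      rw [eg]
      simp only [Pi.add_apply, Pi.smul_apply, smul_eq_mul]
      calc |X i| = |(X i + (μ - 1) * h i + b i) - ((μ - 1) * h i + b i)| := by congr 1; ring
        _ ≤ _ := abs_sub _ _)
    refine h1.trans (mul_le_mul_of_nonneg_left ?_ (Real.sqrt_nonneg _))
    have h2 := nr_add_le ((μ - 1) • h) b W
    rw [nr_smul] at h2
    have h3 : nr h W ≤ norm2 h := nr_mono _ (Finset.subset_univ _)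
    have h4 := mul_le_mul_of_nonneg_left h3 (abs_nonneg (μ - 1))
    linarith
  have hselr : 1 ≤ μ → nr X (S \ V) ≤ Real.sqrt 2 * nr ((μ - 1) • _root_.restrict d U + b) W := by
    intro hμ1
    refine sel hV S hS X _ (by
      intro j hj hjS
      rw [eg, hX j hjS]
      by_cases hjU : j ∈ U
      · simp [_root_.restrict, hjU, hh, hd, huU j hjU]
      · simp [_root_.restrict, hjU, hh, hX j hjS, huU' j hjU]) (by
      intro i hi hiV
      rw [eg]
      simp only [Pi.add_apply, Pi.smul_apply, smul_eq_mul]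
      by_cases hiU : i ∈ U
      · have e1 : _root_.restrict d U i = h i := by
          simp [_root_.restrict, hiU, hh, hd, huU i hiU]
        rw [e1]
        calc |X i| = |(X i + (μ - 1) * h i + b i) - ((μ - 1) * h i + b i)| := by congr 1; ring
          _ ≤ _ := abs_sub _ _
      · have e1 : _root_.restrict d U i = 0 := by simp [_root_.restrict, hiU]
        have e2 : h i = X i := by simp [hh, huU' i hiU]
        rw [e1, e2, mul_zero, zero_add]
        calc |X i| ≤ |μ * X i| := by
              rw [abs_mul, abs_of_nonneg hμ]
              nlinarith [abs_nonneg (X i)]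
          _ = |(X i + (μ - 1) * X i + b i) - b i| := by congr 1; ring
          _ ≤ _ := abs_sub _ _)
  constructor
  · intro hμ1
    refine (hselr hμ1).trans (mul_le_mul_of_nonneg_left ?_ (Real.sqrt_nonneg _))
    have h2 := nr_add_le ((μ - 1) • _root_.restrict d U) b W
    rw [nr_smul, abs_of_nonneg (by linarith)] at h2
    have h3 : nr (_root_.restrict d U) W ≤ nr d Z := by
      refine le_trans ?_ hdU
      rw [← norm2_restrict d U]
      exact nr_mono _ (Finset.subset_univ _)
    have h4 := mul_le_mul_of_nonneg_left h3 (by linarith : 0 ≤ μ - 1)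
    linarith
  · intro hμ1
    set v := _root_.restrict xt (Z \ U) with hv
    set f1 : Fin N → ℝ := fun i => if i ∈ U then - d i else μ * (Φᵀ *ᵥ e) i with hf1
    set f2 : Fin N → ℝ := fun i => if i ∈ U then EE Φ v i else EE Φ h i with hf2
    have hhv : h = d + v := by
      ext i
      by_cases hiU : i ∈ U
      · simp [hh, hd, hv, _root_.restrict, hiU, huU i hiU]
      · by_cases hiZ : i ∈ Z
        · simp [hh, hd, hv, _root_.restrict, hiU, hiZ, huU' i hiU]
        · simp [hh, hd, hv, _root_.restrict, hiZ, huU' i hiU, zero_of_supp hxt.1 hiZ]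
    have er : nr ((μ - 1) • _root_.restrict d U + b) W = nr (f1 + μ • f2) W := by
      refine nr_congr _ _ _ fun i _ => ?_
      by_cases hiU : i ∈ U
      · have h1 := ls_normal hxt i (hUZ hiU)
        have e1 : y - Φ *ᵥ xt = Φ *ᵥ d + e := by rw [hy, hd, mulVec_sub]; abel
        rw [e1, mulVec_add] at h1
        have e2 : EE Φ h i = EE Φ d i + EE Φ v i := by
          rw [hhv]; simp [EE, mulVec_add]; ring
        have e3 : EE Φ d i + d i + (Φᵀ *ᵥ e) i = 0 := by
          simp only [EE, Pi.add_apply, Pi.sub_apply] at h1 ⊢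
          linarith
        simp only [Pi.add_apply, Pi.smul_apply, smul_eq_mul, _root_.restrict, hb, hf1, hf2, hiU,
          if_true, e2]
        linear_combination μ * e3
      · simp only [Pi.add_apply, Pi.smul_apply, smul_eq_mul, _root_.restrict, hb, hf1, hf2, hiU,
          if_false]
        ring
    have hWU : W = (W ∩ U) ∪ (W \ U) := by
      ext i; simp; tauto
    have hWd : Disjoint (W ∩ U) (W \ U) := by
      rw [Finset.disjoint_left]; intro i; simp; tauto
    have hf1W : nr f1 W ^ 2 ≤ nr d Z ^ 2 + (μ * κ) ^ 2 := by
      rw [hWU, nr_union _ hWd]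
      have h1 : nr f1 (W ∩ U) ≤ nr d Z := by
        have : nr f1 (W ∩ U) = nr ((-1 : ℝ) • d) (W ∩ U) := nr_congr _ _ _ fun i hi => by
          simp only [Finset.mem_inter] at hi
          simp [hf1, hi.2]
        rw [this, nr_smul]
        norm_num
        exact nr_mono _ fun i hi => hUZ (Finset.mem_inter.1 hi).2
      have h2 : nr f1 (W \ U) ≤ μ * κ := by
        have : nr f1 (W \ U) = nr (μ • (Φᵀ *ᵥ e)) (W \ U) := nr_congr _ _ _ fun i hi => by
          simp only [Finset.mem_sdiff] at hi
          simp [hf1, hi.2]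
        rw [this, nr_smul, abs_of_nonneg hμ]
        exact mul_le_mul_of_nonneg_left ((nr_mono _ Finset.sdiff_subset).trans hPe) hμ
      exact add_le_add (pow_le_pow_left₀ (nr_nonneg _ _) h1 2)
        (pow_le_pow_left₀ (nr_nonneg _ _) h2 2)
    have hZc : Z.card ≤ 3 * s := (Finset.card_le_card Finset.subset_union_right).trans hSZ
    have hf2W : nr f2 W ^ 2 ≤ δ ^ 2 * (nr d Z ^ 2 + norm2 h ^ 2) := by
      rw [hWU, nr_union _ hWd]
      have h1 : nr f2 (W ∩ U) ≤ δ * nr d Z := by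
        have : nr f2 (W ∩ U) = nr (EE Φ v) (W ∩ U) := nr_congr _ _ _ fun i hi => by
          simp only [Finset.mem_inter] at hi
          simp [hf2, hi.2]
        rw [this]
        refine (EE_le hδ hR Z hZc v (fun i hi => by simp [hv, _root_.restrict, hi]) (W ∩ U)
          fun i hi => hUZ (Finset.mem_inter.1 hi).2).trans ?_
        rw [hv, norm2_restrict]
        exact mul_le_mul_of_nonneg_left hxtU hδ
      have h2 : nr f2 (W \ U) ≤ δ * norm2 h := by
        have : nr f2 (W \ U) = nr (EE Φ h) (W \ U) := nr_congr _ _ _ fun i hi => by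
          simp only [Finset.mem_sdiff] at hi
          simp [hf2, hi.2]
        rw [this]
        exact (nr_mono _ Finset.sdiff_subset).trans hEh
      have h1' := pow_le_pow_left₀ (nr_nonneg _ _) h1 2
      have h2' := pow_le_pow_left₀ (nr_nonneg _ _) h2 2
      nlinarith
    have hnn : 0 ≤ nr d Z ^ 2 + norm2 h ^ 2 := by positivity
    have hf2W' : nr f2 W ≤ δ * Real.sqrt (nr d Z ^ 2 + norm2 h ^ 2) := by
      refine abs_le_of_sq_le_sq' ?_ (mul_nonneg hδ (Real.sqrt_nonneg _)) |>.2
      rw [mul_pow, Real.sq_sqrt hnn]; exact hf2W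
    refine ⟨nr f1 W, Real.sqrt (nr d Z ^ 2 + norm2 h ^ 2), nr_nonneg _ _, Real.sqrt_nonneg _,
      ?_, hf1W, (Real.sq_sqrt hnn).le⟩
    refine (hselr hμ1).trans (mul_le_mul_of_nonneg_left ?_ (Real.sqrt_nonneg _))
    rw [er]
    have h2 := nr_add_le f1 (μ • f2) W
    rw [nr_smul, abs_of_nonneg hμ] at h2
    have h3 := mul_le_mul_of_nonneg_left hf2W' hμ
    linarith

lemma le_sq_aux {a b : ℝ} (hb : 0 ≤ b) (h : a^2 ≤ b^2) : a ≤ b :=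
  (le_abs_self a).trans (abs_le_of_sq_le_sq h hb)

lemma bern_nn {d : ℝ} (h0 : 0 ≤ d) (h1 : d ≤ 0.54) (i j : ℕ) : 0 ≤ d ^ i * (0.54 - d) ^ j :=
  mul_nonneg (pow_nonneg h0 i) (pow_nonneg (by linarith) j)

lemma pb_al {d : ℝ} (h0 : 0 ≤ d) (h1 : d ≤ 0.54) :
    1 + d*(1.74-0.57*d^2) ≤ (1+1.74*d+d^2+2.5*d^3)*(1-d^2) := by
  linarith [bern_nn h0 h1 0 5, bern_nn h0 h1 1 4, bern_nn h0 h1 2 3, bern_nn h0 h1 3 2, bern_nn h0 h1 4 1, bern_nn h0 h1 5 0]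

lemma pb_R {d : ℝ} (h0 : 0 ≤ d) (h1 : d ≤ 0.54) :
    3-2*d^2 ≤ (1.74-0.57*d^2)^2 := by
  linarith [bern_nn h0 h1 0 4, bern_nn h0 h1 1 3, bern_nn h0 h1 2 2, bern_nn h0 h1 3 1, bern_nn h0 h1 4 0]

lemma pb_om {d : ℝ} (h0 : 0 ≤ d) (h1 : d ≤ 0.54) :
    2*1^2+3*(1+1.74*d+d^2+2.5*d^3)^2 ≤ (2.25+2.34*d+2*d^2+5*d^3)^2 := by
  linarith [bern_nn h0 h1 0 6, bern_nn h0 h1 1 5, bern_nn h0 h1 2 4, bern_nn h0 h1 3 3, bern_nn h0 h1 4 2, bern_nn h0 h1 5 1, bern_nn h0 h1 6 0]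

lemma pb_alu {d : ℝ} (h0 : 0 ≤ d) (h1 : d ≤ 0.54) :
    (1+1.74*d+d^2+2.5*d^3) ≤ 5.4 := by
  linarith [bern_nn h0 h1 0 3, bern_nn h0 h1 1 2, bern_nn h0 h1 2 1, bern_nn h0 h1 3 0]

lemma pb_0 {d : ℝ} (h0 : 0 ≤ d) (h1 : d ≤ 0.54) :
    1^2 + 2*(1-d^2)*(2.25+2.34*d+2*d^2+5*d^3)^2 ≤ (1+1.414*(1-0.55*d^2)+2.326*1*(1-0.55*d^2)+1.847*d*1*(2.414+d))^2 := by
  linarith [bern_nn h0 h1 0 8, bern_nn h0 h1 1 7, bern_nn h0 h1 2 6, bern_nn h0 h1 3 5, bern_nn h0 h1 4 4, bern_nn h0 h1 5 3, bern_nn h0 h1 6 2, bern_nn h0 h1 7 1, bern_nn h0 h1 8 0]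

lemma pb_1 {d : ℝ} (h0 : 0 ≤ d) (h1 : d ≤ 0.54) :
    1^2 + 2*(1-d^2)*(d*(2.25+2.34*d+2*d^2+5*d^3)+1)^2 ≤ (1+1.414*(1-0.55*d^2)+2.326*d*(1-0.55*d^2)+1.847*d*d*(2.414+d))^2 := by
  linarith [bern_nn h0 h1 0 10, bern_nn h0 h1 1 9, bern_nn h0 h1 2 8, bern_nn h0 h1 3 7, bern_nn h0 h1 4 6, bern_nn h0 h1 5 5, bern_nn h0 h1 6 4, bern_nn h0 h1 7 3, bern_nn h0 h1 8 2, bern_nn h0 h1 9 1, bern_nn h0 h1 10 0]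

lemma pb_2 {d : ℝ} (h0 : 0 ≤ d) (h1 : d ≤ 0.54) :
    1^2 + 2*(1-d^2)*((1+1.74*d+d^2+2.5*d^3)+2*(d*(2.25+2.34*d+2*d^2+5*d^3)+1))^2 ≤ (1+1.414*(1-0.55*d^2)+2.326*(1+2*d)*(1-0.55*d^2)+1.847*d*(1+2*d)*(2.414+d))^2 := by
  linarith [bern_nn h0 h1 0 10, bern_nn h0 h1 1 9, bern_nn h0 h1 2 8, bern_nn h0 h1 3 7, bern_nn h0 h1 4 6, bern_nn h0 h1 5 5, bern_nn h0 h1 6 4, bern_nn h0 h1 7 3, bern_nn h0 h1 8 2, bern_nn h0 h1 9 1, bern_nn h0 h1 10 0]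

lemma pb_B {d : ℝ} (h0 : 0 ≤ d) (h1 : d ≤ 0.54) :
    1^2 + 2*(1-d^2)*(1.44+0.8*(1+1.74*d+d^2+2.5*d^3)+2.32*d*(2.25+2.34*d+2*d^2+5*d^3))^2 ≤ (1+1.414*(1-0.55*d^2)+2.326*(1+2*d)*(1-0.55*d^2)+1.847*d*(1+2*d)*(2.414+d))^2 := by
  linarith [bern_nn h0 h1 0 10, bern_nn h0 h1 1 9, bern_nn h0 h1 2 8, bern_nn h0 h1 3 7, bern_nn h0 h1 4 6, bern_nn h0 h1 5 5, bern_nn h0 h1 6 4, bern_nn h0 h1 7 3, bern_nn h0 h1 8 2, bern_nn h0 h1 9 1, bern_nn h0 h1 10 0]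

lemma pb_S {d : ℝ} (h0 : 0 ≤ d) (h1 : d ≤ 0.54) :
    0^2 + 2*(1-d^2)*(1+1.16*d*(2.25+2.34*d+2*d^2+5*d^3))^2 ≤ ((1+d)*(2.326*(1-0.55*d^2)+1.847*d*(2.414+d)))^2 := by
  linarith [bern_nn h0 h1 0 10, bern_nn h0 h1 1 9, bern_nn h0 h1 2 8, bern_nn h0 h1 3 7, bern_nn h0 h1 4 6, bern_nn h0 h1 5 5, bern_nn h0 h1 6 4, bern_nn h0 h1 7 3, bern_nn h0 h1 8 2, bern_nn h0 h1 9 1, bern_nn h0 h1 10 0]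

lemma mink {x y z a1 a2 b1 b2 A B : ℝ} (hz : z^2 ≤ x^2 + y^2) (hx : 0 ≤ x) (hy : 0 ≤ y)
    (hx' : x ≤ a1 + b1) (hy' : y ≤ a2 + b2)
    (hA0 : 0 ≤ A) (hB0 : 0 ≤ B) (hA : a1^2 + a2^2 ≤ A^2) (hB : b1^2 + b2^2 ≤ B^2) :
    z ≤ A + B := by
  have h1 : x^2 ≤ (a1+b1)^2 := by nlinarith
  have h2 : y^2 ≤ (a2+b2)^2 := by nlinarith
  have h3 : a1*b1 + a2*b2 ≤ A*B := by
    refine le_sq_aux (by positivity) ?_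
    have : (a1^2 + a2^2) * (b1^2+b2^2) ≤ A^2 * B^2 :=
      mul_le_mul hA hB (by positivity) (by positivity)
    nlinarith [sq_nonneg (a1*b2 - a2*b1)]
  refine le_sq_aux (by positivity) ?_
  nlinarith

lemma conv2 {a0 a1 c g0 g1 y0 y1 : ℝ} (hc : 0 ≤ c) (h0 : 0 ≤ y0) (h1 : 0 ≤ y1)
    (H0 : a0^2 + c*g0^2 ≤ y0^2) (H1 : a1^2 + c*g1^2 ≤ y1^2) :
    (a0+a1)^2 + c*(g0+g1)^2 ≤ (y0+y1)^2 := by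
  have h3 : a0*a1 + c*(g0*g1) ≤ y0*y1 := by
    refine le_sq_aux (by positivity) ?_
    have : (a0^2 + c*g0^2) * (a1^2+c*g1^2) ≤ y0^2 * y1^2 :=
      mul_le_mul H0 H1 (by positivity) (by positivity)
    nlinarith [mul_nonneg hc (sq_nonneg (a0*g1 - a1*g0))]
  nlinarith

lemma quadsolve {D p a δ κ σ P1 P2 K : ℝ} (hD : D^2 ≤ p^2 + a^2) (ha0 : 0 ≤ a)
    (hκ : 0 ≤ κ) (hp : 0 ≤ p) (hσ0 : 0 ≤ σ)
    (ha : a ≤ δ*D + κ) (hσ : σ^2 = 1 - δ^2) (hP : σ*p ≤ P1 + P2) (hP1 : 0 ≤ P1) (hK0 : 0 ≤ K)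
    (hK : κ^2 + P2^2 ≤ K^2) : σ^2*D ≤ δ*κ + P1 + K := by
  have h1 : a^2 ≤ (δ*D+κ)^2 := by
    apply pow_le_pow_left₀ ha0 ha
  have h2 : σ^2*D^2 - 2*δ*D*κ ≤ p^2 + κ^2 := by rw [hσ]; nlinarith
  have h3 : (σ^2*D - δ*κ)^2 ≤ (σ*p)^2 + κ^2 := by
    have h4 := mul_le_mul_of_nonneg_left h2 (sq_nonneg σ)
    have h5 : δ^2*κ^2 + σ^2*κ^2 = κ^2 := by rw [hσ]; ring
    nlinarith
  have := mink (A := P1) (B := K) (b1 := P2) (a2 := 0) (b2 := κ) h3 (by positivity) hκ hP (by linarith) hP1 hK0 (by linarith) (by linarith)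
  linarith

noncomputable def alh (d : ℝ) : ℝ := 1+1.74*d+d^2+2.5*d^3
noncomputable def omh (d : ℝ) : ℝ := 2.25+2.34*d+2*d^2+5*d^3
noncomputable def Yl (d e : ℝ) : ℝ :=
  1+1.414*(1-0.55*d^2)+2.326*e*(1-0.55*d^2)+1.847*d*e*(2.414+d)

lemma first_half {δ t κ σ v r p a D w : ℝ} (h0 : 0 ≤ δ) (h1 : δ ≤ 0.54) (hσ0 : 0 < σ)
    (hσ : σ^2 = 1 - δ^2) (hv0 : 0 ≤ v) (hv : v^2 = 1 + 2*δ^2) (hr0 : 0 ≤ r) (hr : r^2 = 2)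
    (ht : 0 ≤ t) (hκ : 0 ≤ κ) (hp0 : 0 ≤ p) (ha0 : 0 ≤ a)
    (hp : p ≤ r * (δ*t + κ)) (hD : D^2 = p^2 + a^2) (ha : a ≤ δ*D + κ)
    (hw : w^2 ≤ p^2 + 3*a^2) :
    σ*a ≤ r*δ^2*t + σ*alh δ*κ ∧ σ*w ≤ r*δ*v*t + σ*omh δ*κ := by
  have hR0 : 0 ≤ 1.74-0.57*δ^2 := by nlinarith
  have hal0 : 0 ≤ alh δ := by unfold alh; positivity
  have hom0 : 0 ≤ omh δ := by unfold omh; positivity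
  have hsp : σ*p ≤ r*δ*σ*t + r*σ*κ := by
    have := mul_le_mul_of_nonneg_left hp hσ0.le
    linarith
  have hq := quadsolve (K := (1.74-0.57*δ^2)*κ) hD.le ha0 hκ hp0 hσ0.le ha hσ hsp (by positivity)
    (by positivity) (by
      have := mul_le_mul_of_nonneg_right (pb_R h0 h1) (sq_nonneg κ)
      have e : (r*σ*κ)^2 = 2*(1-δ^2)*κ^2 := by rw [← hr, ← hσ]; ring
      rw [e]; linarith)
  have hA : σ*a ≤ r*δ^2*t + σ*alh δ*κ := by
    have e1 := mul_le_mul_of_nonneg_left ha (sq_nonneg σ)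
    have e2 := mul_le_mul_of_nonneg_left hq h0
    have e3 := mul_le_mul_of_nonneg_right (pb_al h0 h1) hκ
    have e4 : σ^2*κ = (1-δ^2)*κ := by rw [hσ]
    have e5 : σ*(σ*alh δ*κ) = alh δ*(1-δ^2)*κ := by rw [← hσ]; ring
    have e3' : (1 + δ*(1.74-0.57*δ^2)) * κ ≤ alh δ*(1-δ^2)*κ := e3
    have : σ*(σ*a) ≤ σ*(r*δ^2*t + σ*alh δ*κ) := by
      rw [mul_add, e5]; linarith
    exact le_of_mul_le_mul_left this hσ0
  refine ⟨hA, ?_⟩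
  obtain ⟨θ, h30, h3⟩ : ∃ θ : ℝ, 0 ≤ θ ∧ θ^2 = 3 :=
    ⟨Real.sqrt 3, Real.sqrt_nonneg 3, Real.sq_sqrt (by norm_num)⟩
  have hz : (σ*w)^2 ≤ (σ*p)^2 + (θ*(σ*a))^2 := by
    have := mul_le_mul_of_nonneg_left hw (sq_nonneg σ)
    have e : (θ*(σ*a))^2 = 3*(σ*a)^2 := by rw [mul_pow, h3]
    rw [e]; linarith
  have hy := mul_le_mul_of_nonneg_left hA h30
  rw [mul_add] at hy
  refine mink hz (by positivity) (by positivity) hsp hy (by positivity) (by positivity) ?_ ?_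
  · have e1 : (r*δ*σ*t)^2 = 2*δ^2*(1-δ^2)*t^2 := by rw [← hr, ← hσ]; ring
    have e2 : (θ*(r*δ^2*t))^2 = 3*2*δ^4*t^2 := by
      linear_combination (r^2*δ^4*t^2)*h3 + 3*δ^4*t^2*hr
    have e3 : (r*δ*v*t)^2 = 2*δ^2*(1+2*δ^2)*t^2 := by
      linear_combination (δ^2*v^2*t^2)*hr + 2*δ^2*t^2*hv
    rw [e1, e2, e3]; linarith
  · have e1 : (r*σ*κ)^2 = 2*(σ^2*κ^2) := by rw [← hr]; ring
    have e2 : (θ*(σ*alh δ*κ))^2 = 3*(alh δ)^2*(σ^2*κ^2) := by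
      linear_combination (σ*alh δ*κ)^2*h3
    have := mul_le_mul_of_nonneg_right (pb_om h0 h1) (show 0 ≤ σ^2*κ^2 by positivity)
    have h' : (2*1^2+3*(alh δ)^2)*(σ^2*κ^2) ≤ (omh δ)^2*(σ^2*κ^2) := this
    rw [e1, e2]; linarith

lemma v_ge_one {δ v : ℝ} (hv0 : 0 ≤ v) (hv : v^2 = 1 + 2*δ^2) : 1 ≤ v := by
  refine le_sq_aux hv0 ?_
  nlinarith [sq_nonneg δ]

lemma slope_aux {δ μ v : ℝ} (h0 : 0 ≤ δ) (h1 : δ ≤ 0.54) (hm2 : 2 ≤ μ) (hv1 : 1 ≤ v) :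
    δ+μ*δ*(v+δ^2/2) ≤ (μ-1+μ*δ)*v := by
  have hd3 : δ^3 ≤ 0.16 := by
    have := pow_le_pow_left₀ h0 h1 3
    norm_num at this ⊢; linarith
  have k1 : μ*δ^3 ≤ μ*0.16 := mul_le_mul_of_nonneg_left hd3 (by linarith)
  have k2 : 0 ≤ (μ-1)*(v-1) := mul_nonneg (by linarith) (by linarith)
  linarith

set_option maxHeartbeats 1000000 in
lemma second_half {δ μ t κ σ v r a w q : ℝ} (h0 : 0 ≤ δ) (h1 : δ ≤ 0.54) (hσ0 : 0 < σ)
    (hσ : σ^2 = 1 - δ^2) (hv0 : 0 ≤ v) (hv : v^2 = 1 + 2*δ^2) (hr0 : 0 ≤ r) (hr : r^2 = 2)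
    (ht : 0 ≤ t) (hκ : 0 ≤ κ) (hμ : 0 ≤ μ) (ha0 : 0 ≤ a) (hw0 : 0 ≤ w)
    (hA : σ*a ≤ r*δ^2*t + σ*alh δ*κ) (hW : σ*w ≤ r*δ*v*t + σ*omh δ*κ)
    (hq1 : q ≤ r * (|μ-1| * w + μ*(δ*w + κ)))
    (hq2 : 1 ≤ μ → q ≤ r * ((μ-1)*a + μ*(δ*w + κ)))
    (hq3 : 1 ≤ μ → ∃ r1 r2, 0 ≤ r1 ∧ 0 ≤ r2 ∧ q ≤ r*(r1 + μ*δ*r2) ∧ r1^2 ≤ a^2 + (μ*κ)^2 ∧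
      r2^2 ≤ a^2 + w^2) :
    ∃ g : ℝ, 0 ≤ g ∧ σ*q ≤ 2*δ*(|μ-1|+μ*δ)*v*t + σ*(r*g*κ) ∧
      1 + 2*(1-δ^2)*g^2 ≤ (Yl δ (|μ-1|+μ*δ))^2 := by
  have hv1 := v_ge_one hv0 hv
  have hal0 : 0 ≤ alh δ := by unfold alh; positivity
  have hom0 : 0 ≤ omh δ := by unfold omh; positivity
  have hs0 : 0 ≤ 1-0.55*δ^2 := by nlinarith
  have hc : 0 ≤ 2*(1-δ^2) := by nlinarith
  have hY0 : ∀ e, 0 ≤ e → 0 ≤ Yl δ e := fun e he => by unfold Yl; positivity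
  rcases le_total μ 1 with hm | hm
  · have hab : |μ-1| = 1-μ := by rw [abs_of_nonpos (by linarith)]; ring
    rw [hab] at hq1 ⊢
    have hη : 0 ≤ 1-μ+μ*δ := by nlinarith [mul_nonneg hμ h0]
    refine ⟨(1-μ+μ*δ)*omh δ + μ, by positivity, ?_, ?_⟩
    · have e1 := mul_le_mul_of_nonneg_left hq1 hσ0.le
      have e2 := mul_le_mul_of_nonneg_left hW (mul_nonneg hr0 hη)
      have e3 : r*(1-μ+μ*δ)*(r*δ*v*t) = 2*δ*(1-μ+μ*δ)*v*t := by rw [← hr]; ring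
      linarith
    · have H0 : 1^2 + 2*(1-δ^2)*(omh δ)^2 ≤ (Yl δ 1)^2 := pb_0 h0 h1
      have H1 : 1^2 + 2*(1-δ^2)*(δ*omh δ+1)^2 ≤ (Yl δ δ)^2 := pb_1 h0 h1
      have hm' : 0 ≤ 1-μ := by linarith
      have := conv2 (a0 := 1-μ) (a1 := μ) (g0 := (1-μ)*omh δ) (g1 := μ*(δ*omh δ+1))
        (y0 := (1-μ)*Yl δ 1) (y1 := μ*Yl δ δ) hc (mul_nonneg hm' (hY0 _ zero_le_one))
        (mul_nonneg hμ (hY0 _ h0))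
        (by have := mul_le_mul_of_nonneg_left H0 (sq_nonneg (1-μ)); linarith)
        (by have := mul_le_mul_of_nonneg_left H1 (sq_nonneg μ); linarith)
      have ey : (1-μ)*Yl δ 1 + μ*Yl δ δ = Yl δ (1-μ+μ*δ) := by unfold Yl; ring
      have eg : (1-μ)*omh δ + μ*(δ*omh δ+1) = (1-μ+μ*δ)*omh δ + μ := by ring
      rw [ey, eg] at this
      linarith
  · have hab : |μ-1| = μ-1 := abs_of_nonneg (by linarith)
    rw [hab]
    have hm0 : 0 ≤ μ-1 := by linarith
    have H2 : 1^2 + 2*(1-δ^2)*(alh δ+2*(δ*omh δ+1))^2 ≤ (Yl δ (1+2*δ))^2 := pb_2 h0 h1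
    rcases le_total μ 2 with hm2 | hm2
    · refine ⟨(μ-1)*alh δ + μ*(δ*omh δ+1), by positivity, ?_, ?_⟩
      · have e1 := mul_le_mul_of_nonneg_left (hq2 hm) hσ0.le
        have e2 := mul_le_mul_of_nonneg_left hW (mul_nonneg hr0 (mul_nonneg hμ h0))
        have e4 := mul_le_mul_of_nonneg_left hA (mul_nonneg hr0 hm0)
        have e3 : r*(μ*δ)*(r*δ*v*t) = 2*δ*(μ*δ)*v*t := by rw [← hr]; ring
        have e5 : r*(μ-1)*(r*δ^2*t) = 2*δ*(μ-1)*δ*t := by rw [← hr]; ring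
        have e6 : 2*δ*(μ-1)*δ*t ≤ 2*δ*(μ-1)*v*t := by
          have : δ ≤ v := by linarith
          gcongr
        rw [mul_add, e3] at e2
        rw [mul_add, e5] at e4
        linarith
      · have H1 : 1^2 + 2*(1-δ^2)*(δ*omh δ+1)^2 ≤ (Yl δ δ)^2 := pb_1 h0 h1
        have hm' : 0 ≤ 2-μ := by linarith
        have := conv2 (a0 := 2-μ) (a1 := μ-1) (g0 := (2-μ)*(δ*omh δ+1))
          (g1 := (μ-1)*(alh δ+2*(δ*omh δ+1)))
          (y0 := (2-μ)*Yl δ δ) (y1 := (μ-1)*Yl δ (1+2*δ)) hc (mul_nonneg hm' (hY0 _ h0))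
          (mul_nonneg hm0 (hY0 _ (by positivity)))
          (by have := mul_le_mul_of_nonneg_left H1 (sq_nonneg (2-μ)); linarith)
          (by have := mul_le_mul_of_nonneg_left H2 (sq_nonneg (μ-1)); linarith)
        have ey : (2-μ)*Yl δ δ + (μ-1)*Yl δ (1+2*δ) = Yl δ (μ-1+μ*δ) := by unfold Yl; ring
        have eg : (2-μ)*(δ*omh δ+1) + (μ-1)*(alh δ+2*(δ*omh δ+1))
          = (μ-1)*alh δ + μ*(δ*omh δ+1) := by ring
        rw [ey, eg] at this
        linarith
    · obtain ⟨r1, r2, hr1, hr2, hq, hb1, hb2⟩ := hq3 hm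
      have hm2' : 0 ≤ μ-2 := by linarith
      have hal1 : alh δ ≤ 5.4 := pb_alu h0 h1
      have hal2 : 1 ≤ alh δ := by
        have : 0 ≤ 1.74*δ+δ^2+2.5*δ^3 := by positivity
        unfold alh; linarith
      have hr1' : σ*r1 ≤ r*δ^2*t + σ*(1.44+0.8*alh δ + (μ-2))*κ := by
        have hz : (σ*r1)^2 ≤ (σ*a)^2 + (σ*μ*κ)^2 := by
          have := mul_le_mul_of_nonneg_left hb1 (sq_nonneg σ)
          linarith
        refine mink (a2 := 0) (b2 := σ*μ*κ) hz (by positivity) (by positivity) hA (by linarith) (by positivity) (by positivity)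
          (by linarith) ?_
        have : (alh δ)^2 + μ^2 ≤ (1.44+0.8*alh δ + (μ-2))^2 := by nlinarith
        have := mul_le_mul_of_nonneg_left this (show 0 ≤ (σ*κ)^2 by positivity)
        linarith
      have hr2' : σ*r2 ≤ r*δ*(v+δ^2/2)*t + σ*(1.16*omh δ)*κ := by
        have hz : (σ*r2)^2 ≤ (σ*a)^2 + (σ*w)^2 := by
          have := mul_le_mul_of_nonneg_left hb2 (sq_nonneg σ)
          linarith
        refine mink hz (by positivity) (by positivity) hA hW (by positivity) (by positivity) ?_ ?_
        · have : δ^2 + v^2 ≤ (v+δ^2/2)^2 := by nlinarith [sq_nonneg δ, mul_nonneg (sq_nonneg δ) (sub_nonneg.2 hv1), sq_nonneg (δ^2)]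
          have := mul_le_mul_of_nonneg_left this (show 0 ≤ (r*δ*t)^2 by positivity)
          linarith
        · have : 2*1^2+3*(alh δ)^2 ≤ (omh δ)^2 := pb_om h0 h1
          have : (alh δ)^2 + (omh δ)^2 ≤ (1.16*omh δ)^2 := by nlinarith
          have := mul_le_mul_of_nonneg_left this (show 0 ≤ (σ*κ)^2 by positivity)
          linarith
      refine ⟨1.44+0.8*alh δ + (μ-2) + μ*δ*(1.16*omh δ), by positivity, ?_, ?_⟩
      · have e1 := mul_le_mul_of_nonneg_left hq hσ0.le
        have e2 := mul_le_mul_of_nonneg_left hr2' (mul_nonneg hr0 (mul_nonneg hμ h0))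
        have e4 := mul_le_mul_of_nonneg_left hr1' hr0
        have e3 : r*(μ*δ)*(r*δ*(v+δ^2/2)*t) = 2*δ*(μ*δ)*(v+δ^2/2)*t := by rw [← hr]; ring
        have e5 : r*(r*δ^2*t) = 2*δ*δ*t := by rw [← hr]; ring
        have e6 : 2*δ*t*(δ+μ*δ*(v+δ^2/2)) ≤ 2*δ*t*((μ-1+μ*δ)*v) := by
          have := slope_aux h0 h1 hm2 hv1
          gcongr
        rw [mul_add, e3] at e2
        rw [mul_add, e5] at e4
        linarith
      · have HB : 1^2 + 2*(1-δ^2)*(1.44+0.8*alh δ+2.32*δ*omh δ)^2 ≤ (Yl δ (1+2*δ))^2 := pb_B h0 h1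
        have HS : 0^2 + 2*(1-δ^2)*(1+1.16*δ*omh δ)^2 ≤
          ((1+δ)*(2.326*(1-0.55*δ^2)+1.847*δ*(2.414+δ)))^2 := pb_S h0 h1
        have := conv2 (a0 := 1) (a1 := 0) (g0 := 1.44+0.8*alh δ+2.32*δ*omh δ)
          (g1 := (μ-2)*(1+1.16*δ*omh δ)) (y0 := Yl δ (1+2*δ))
          (y1 := (μ-2)*((1+δ)*(2.326*(1-0.55*δ^2)+1.847*δ*(2.414+δ)))) hc
          (hY0 _ (by positivity)) (by positivity) HB
          (by have := mul_le_mul_of_nonneg_left HS (sq_nonneg (μ-2)); linarith)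
        have ey : Yl δ (1+2*δ) + (μ-2)*((1+δ)*(2.326*(1-0.55*δ^2)+1.847*δ*(2.414+δ)))
          = Yl δ (μ-1+μ*δ) := by unfold Yl; ring
        have eg : 1.44+0.8*alh δ+2.32*δ*omh δ + (μ-2)*(1+1.16*δ*omh δ)
          = 1.44+0.8*alh δ + (μ-2) + μ*δ*(1.16*omh δ) := by ring
        rw [ey, eg] at this
        linarith

lemma delta_small {δ μ v : ℝ} (h0 : 0 ≤ δ) (hδ1 : δ < 1) (hμ : 0 ≤ μ) (hv0 : 0 ≤ v)
    (hv : v^2 = 1 + 2*δ^2) (h : 2*δ*(|μ-1|+μ*δ)*v < 1 - δ^2) : δ ≤ 0.54 := by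
  by_contra hc
  push Not at hc
  have hη : δ ≤ |μ-1|+μ*δ := by
    rcases le_total μ 1 with hm | hm
    · rw [abs_of_nonpos (by linarith)]; nlinarith
    · rw [abs_of_nonneg (by linarith)]; nlinarith
  have hv1 : 1.25 ≤ v := le_sq_aux hv0 (by rw [hv]; nlinarith)
  have : 2*δ*δ*1.25 ≤ 2*δ*(|μ-1|+μ*δ)*v := by gcongr
  nlinarith

lemma third {δ μ t κ σ v r q α t' : ℝ} (h0 : 0 ≤ δ) (hσ0 : 0 < σ)
    (hσ : σ^2 = 1 - δ^2) (hv0 : 0 ≤ v) (hr : r^2 = 2)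
    (ht : 0 ≤ t) (hκ : 0 ≤ κ) (hμ : 0 ≤ μ) (hq0 : 0 ≤ q) (hα0 : 0 ≤ α) {Y g : ℝ} (hY : 0 ≤ Y)
    (ht' : t'^2 = q^2 + α^2) (hα : α ≤ δ*t' + κ)
    (hq : σ*q ≤ 2*δ*(|μ-1|+μ*δ)*v*t + σ*(r*g*κ))
    (hg : 1 + 2*(1-δ^2)*g^2 ≤ Y^2) :
    σ^2*t' ≤ 2*δ*(|μ-1|+μ*δ)*v*t + (δ+Y)*κ := by
  have := quadsolve (K := Y*κ) ht'.le hα0 hκ hq0 hσ0.le hα hσ hq (by positivity) (by positivity) (by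
    have := mul_le_mul_of_nonneg_right hg (sq_nonneg κ)
    have e : (σ*(r*g*κ))^2 = 2*(1-δ^2)*g^2*κ^2 := by rw [← hσ, ← hr]; ring
    rw [e]; linarith)
  linarith

lemma sig_aux {δ σ : ℝ} (h0 : 0 ≤ δ) (hsm : δ ≤ 0.54) (hσ0 : 0 < σ) (hσ : σ^2 = 1 - δ^2) :
    1-0.55*δ^2 ≤ σ ∧ 0 ≤ 1-0.55*δ^2 ∧ 1 + δ ≤ (1+δ)/σ := by
  have hd : δ^2 ≤ 0.3 := by nlinarith
  have hs0 : 0 ≤ 1-0.55*δ^2 := by linarith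
  have hσ1 : σ ≤ 1 := le_sq_aux zero_le_one (by rw [hσ]; nlinarith [sq_nonneg δ])
  refine ⟨?_, hs0, ?_⟩
  · refine le_sq_aux hσ0.le ?_
    rw [hσ]
    nlinarith [sq_nonneg δ]
  · rw [le_div_iff₀ hσ0]
    exact mul_le_of_le_one_right (by linarith) hσ1

lemma C_id {δ σ l k r c1 c2 η C : ℝ} (hl0 : 0 < l) (hk0 : 0 < k)
    (hl : l^2 = 1 - δ) (hk : k^2 = 1 + δ) (hkl : σ = k * l)
    (hC : C = (c1 * δ * η / σ + 1) * ((r * l + k) / (1 - δ)) + c2 * η / l) :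
    C*σ^2 = k*(δ + (1 + r*σ + c2*η*σ + c1*δ*η*(r+(1+δ)/σ))) := by
  have e : k*(δ + (1 + r*σ + c2*η*σ + c1*δ*η*(r+(1+δ)/σ))) =
      k*(k^2 + r*σ + c2*η*σ + c1*δ*η*(r+k^2/σ)) := by rw [hk]; ring
  rw [e, hC, hkl, ← hl]
  field_simp
  ring

set_option maxHeartbeats 1000000 in
lemma step_scalar {δ μ t ε κ ρ C p a D w q α t' : ℝ} (h0 : 0 ≤ δ) (hδ1 : δ < 1) (hμ : 0 ≤ μ)
    (hρ : ρ = 2 * δ * (|μ - 1| + μ * δ) * Real.sqrt (1 + 2 * δ ^ 2) / (1 - δ ^ 2))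
    (hρ1 : ρ < 1)
    (hC : C = (Real.sqrt (2 + Real.sqrt 2) * δ * (|μ - 1| + μ * δ) / Real.sqrt (1 - δ ^ 2) + 1) *
        ((Real.sqrt (2 * (1 - δ)) + Real.sqrt (1 + δ)) / (1 - δ)) +
        Real.sqrt (4 + Real.sqrt 2) * (|μ - 1| + μ * δ) / Real.sqrt (1 - δ))
    (ht : 0 ≤ t) (hε : 0 ≤ ε) (hκ : κ = Real.sqrt (1 + δ) * ε)
    (hp0 : 0 ≤ p) (ha0 : 0 ≤ a) (hw0 : 0 ≤ w) (hq0 : 0 ≤ q) (hα0 : 0 ≤ α)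
    (hp : p ≤ Real.sqrt 2 * (δ*t + κ)) (hD : D^2 = p^2 + a^2) (ha : a ≤ δ*D + κ)
    (hw : w^2 ≤ p^2 + 3*a^2)
    (ht' : t'^2 = q^2 + α^2) (hα : α ≤ δ*t' + κ)
    (hq1 : q ≤ Real.sqrt 2 * (|μ-1| * w + μ*(δ*w + κ)))
    (hq2 : 1 ≤ μ → q ≤ Real.sqrt 2 * ((μ-1)*a + μ*(δ*w + κ)))
    (hq3 : 1 ≤ μ → ∃ r1 r2, 0 ≤ r1 ∧ 0 ≤ r2 ∧ q ≤ Real.sqrt 2*(r1 + μ*δ*r2) ∧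
      r1^2 ≤ a^2 + (μ*κ)^2 ∧ r2^2 ≤ a^2 + w^2) :
    t' ≤ ρ * t + C * ε := by
  have h1d : 0 < 1 - δ := by linarith
  have h1s : 0 < 1 - δ^2 := by nlinarith
  have hσ : Real.sqrt (1 - δ^2) ^ 2 = 1 - δ^2 := Real.sq_sqrt h1s.le
  have hσ0 : 0 < Real.sqrt (1 - δ^2) := Real.sqrt_pos.2 h1s
  have hl : Real.sqrt (1 - δ) ^ 2 = 1 - δ := Real.sq_sqrt h1d.le
  have hl0 : 0 < Real.sqrt (1 - δ) := Real.sqrt_pos.2 h1d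
  have hk : Real.sqrt (1 + δ) ^ 2 = 1 + δ := Real.sq_sqrt (by linarith)
  have hk0 : 0 < Real.sqrt (1 + δ) := Real.sqrt_pos.2 (by linarith)
  have hkl : Real.sqrt (1 - δ^2) = Real.sqrt (1 + δ) * Real.sqrt (1 - δ) := by
    rw [← Real.sqrt_mul (by linarith)]; congr 1; ring
  have h2l : Real.sqrt (2 * (1 - δ)) = Real.sqrt 2 * Real.sqrt (1 - δ) :=
    Real.sqrt_mul (by norm_num) _
  have hv : Real.sqrt (1 + 2 * δ ^ 2) ^ 2 = 1 + 2*δ^2 := Real.sq_sqrt (by positivity)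
  have hv0 := Real.sqrt_nonneg (1 + 2 * δ ^ 2)
  have hr : Real.sqrt 2 ^ 2 = 2 := Real.sq_sqrt (by norm_num)
  have hr0 := Real.sqrt_nonneg 2
  have hrb : 1.414 ≤ Real.sqrt 2 := Real.le_sqrt_of_sq_le (by norm_num)
  have hc1 : 1.847 ≤ Real.sqrt (2 + Real.sqrt 2) :=
    Real.le_sqrt_of_sq_le (by norm_num at hrb ⊢; linarith)
  have hc2 : 2.326 ≤ Real.sqrt (4 + Real.sqrt 2) :=
    Real.le_sqrt_of_sq_le (by norm_num at hrb ⊢; linarith)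
  rw [h2l] at hC
  generalize Real.sqrt (2 + Real.sqrt 2) = c1 at *
  generalize Real.sqrt (4 + Real.sqrt 2) = c2 at *
  generalize Real.sqrt (1 + 2 * δ ^ 2) = v at *
  generalize Real.sqrt (1 - δ ^ 2) = σ at *
  generalize Real.sqrt (1 - δ) = l at *
  generalize Real.sqrt (1 + δ) = k at *
  generalize Real.sqrt 2 = r at *
  have hκ0 : 0 ≤ κ := by rw [hκ]; positivity
  have hη : 0 ≤ |μ-1| + μ*δ := by positivity
  have hsm : δ ≤ 0.54 := by
    refine delta_small h0 hδ1 hμ hv0 hv ?_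
    rw [hρ, div_lt_one h1s] at hρ1
    exact hρ1
  obtain ⟨hA, hW⟩ := first_half h0 hsm hσ0 hσ hv0 hv hr0 hr ht hκ0 hp0 ha0 hp hD ha hw
  obtain ⟨g, hg0, hg1, hg2⟩ := second_half h0 hsm hσ0 hσ hv0 hv hr0 hr ht hκ0 hμ ha0 hw0 hA hW
    hq1 hq2 hq3
  generalize hηd : |μ-1| + μ*δ = η at *
  obtain ⟨hs, hs0, hdiv⟩ := sig_aux h0 hsm hσ0 hσ
  have hYY : Yl δ η ≤ 1 + r*σ + c2*η*σ + c1*δ*η*(r+(1+δ)/σ) := by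
    have e1 : 1.414*(1-0.55*δ^2) ≤ r*σ := by gcongr
    have e2 : 2.326*η*(1-0.55*δ^2) ≤ c2*η*σ := by gcongr
    have e3 : 1.847*δ*η*(2.414+δ) ≤ c1*δ*η*(r+(1+δ)/σ) := by
      have : 2.414+δ ≤ r+(1+δ)/σ := by norm_num at hrb ⊢; linarith
      gcongr
    unfold Yl
    linarith
  have hYl0 : 0 ≤ Yl δ η := by unfold Yl; positivity
  have hY2 := pow_le_pow_left₀ hYl0 hYY 2
  have hfin := third h0 hσ0 hσ hv0 hr ht hκ0 hμ hq0 hα0 (hYl0.trans hYY) ht' hα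
    (by rw [hηd]; exact hg1) (hg2.trans hY2)
  rw [hηd] at hfin
  have hCid : C*σ^2 = k*(δ + (1 + r*σ + c2*η*σ + c1*δ*η*(r+(1+δ)/σ))) := C_id hl0 hk0 hl hk hkl hC
  have hρid : ρ*σ^2 = 2*δ*η*v := by
    rw [hρ, hσ]; field_simp
  have : σ^2*t' ≤ σ^2*(ρ*t + C*ε) := by
    have : σ^2*(ρ*t + C*ε) = (ρ*σ^2)*t + (C*σ^2)*ε := by ring
    rw [this, hρid, hCid]
    rw [hκ] at hfin
    linarith
  exact le_of_mul_le_mul_left this (by positivity)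

theorem stmt_13 {m N : ℕ} (Φ : Matrix (Fin m) (Fin N) ℝ) (s : ℕ)
    (S : Finset (Fin N)) (hS : S.card ≤ s)
    (x : Fin N → ℝ) (e' : Fin m → ℝ) (y : Fin m → ℝ)
    (hy : y = Φ.mulVec (restrict x S) + e')
    (δ μ : ℝ) (hδ0 : 0 ≤ δ) (hδ1 : δ < 1) (hμ : 0 ≤ μ)
    (hRIP : RIP m N Φ (3 * s) δ)
    (ρ C τ : ℝ)
    (hρ : ρ = 2 * δ * (|μ - 1| + μ * δ) * Real.sqrt (1 + 2 * δ ^ 2) / (1 - δ ^ 2))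
    (hρ1 : ρ < 1)
    (hC : C = (Real.sqrt (2 + Real.sqrt 2) * δ * (|μ - 1| + μ * δ) / Real.sqrt (1 - δ ^ 2) + 1) *
        ((Real.sqrt (2 * (1 - δ)) + Real.sqrt (1 + δ)) / (1 - δ)) +
        Real.sqrt (4 + Real.sqrt 2) * (|μ - 1| + μ * δ) / Real.sqrt (1 - δ))
    (hτ : τ = C / (1 - ρ))
    (Sseq : ℕ → Finset (Fin N)) (xseq : ℕ → (Fin N → ℝ))
    (hScard : ∀ n, (Sseq n).card ≤ s)
    (hS0 : Sseq 0 = ∅) (hx0 : xseq 0 = 0)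
    (hstep : ∀ n : ℕ, 1 ≤ n →
      supp (xseq (n - 1)) ⊆ Sseq (n - 1) ∧
      ∃ ΔS : Finset (Fin N),
        IsLargest (Φᵀ.mulVec (y - Φ.mulVec (xseq (n - 1)))) s ΔS ∧
        ∃ xt : Fin N → ℝ,
          IsLeastSquares Φ y (Sseq (n - 1) ∪ ΔS) xt ∧
          ∃ U : Finset (Fin N), U ⊆ Sseq (n - 1) ∪ ΔS ∧ IsLargest xt s U ∧
            IsLargest (fun i => restrict xt U i +
              μ * (Φᵀ.mulVec (y - Φ.mulVec (restrict xt U))) i) s (Sseq n) ∧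
            IsLeastSquares Φ y (Sseq n) (xseq n)) :
    ∀ n : ℕ, norm2 (restrict x S - xseq n) ≤
      ρ ^ n * norm2 (restrict x S) + τ * norm2 e' := by
  have hX : ∀ i ∉ S, (_root_.restrict x S) i = 0 := fun i hi => by
    simp [_root_.restrict, hi]
  have h1s : 0 < 1 - δ^2 := by nlinarith
  have h1d : 0 < 1 - δ := by linarith
  have hρ0 : 0 ≤ ρ := by rw [hρ]; positivity
  have hC0 : 0 ≤ C := by rw [hC]; positivity
  have hτ0 : 0 ≤ τ := by rw [hτ]; exact div_nonneg hC0 (by linarith)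
  have hτC : ρ * τ + C = τ := by
    have : 1 - ρ ≠ 0 := by linarith
    rw [hτ]; field_simp; ring
  have hLS : ∀ n, IsLeastSquares Φ y (Sseq n) (xseq n) := by
    intro n
    rcases Nat.eq_zero_or_pos n with rfl | hn
    · rw [hS0, hx0]
      refine ⟨by simp [supp], fun w hw => ?_⟩
      have : w = 0 := by
        funext i
        by_contra hi
        have : i ∈ supp w := by simpa [supp] using hi
        simpa using hw this
      rw [this]
    · obtain ⟨_, _, _, _, _, _, _, _, _, h⟩ := hstep n hn
      exact h
  intro n
  induction n with
  | zero =>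
    rw [hx0, sub_zero, pow_zero, one_mul]
    have := mul_nonneg hτ0 (norm2_nonneg e')
    linarith
  | succ n ih =>
    obtain ⟨_, Δ, hΔ, xt, hxt, U, hUZ, hU, hV, hxn⟩ := hstep (n+1) (by omega)
    rw [Nat.add_sub_cancel] at hΔ hxt hUZ
    obtain ⟨p, a, D, w, q, α, hp0, ha0, -, hw0, hq0, hα0, hp, hD, ha, hw, ht', hα, hq1, hq2, hq3⟩ :=
      step_vec hδ0 hμ hRIP hS hX hy (hScard n) (hLS n) hΔ hxt hUZ hU hV hxn _ rfl
    have := step_scalar hδ0 hδ1 hμ hρ hρ1 hC (norm2_nonneg _) (norm2_nonneg e') rfl hp0 ha0 hw0 hq0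
      hα0 hp hD ha hw ht' hα hq1 hq2 hq3
    have h2 := mul_le_mul_of_nonneg_left ih hρ0
    have h3 : ρ * τ * norm2 e' + C * norm2 e' = τ * norm2 e' := by
      rw [← add_mul, hτC]
    rw [pow_succ]
    linarith
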